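/- Let b be a slowly varying function and q ∈ (0,1]. Then, up to equivalence of the defining functionals: (1) if either p ∈ (1,∞), or p = 1 and b is equivalent to a non-increasing function, then (L^{p,q,b})' = L^{(p',∞,b^{−1})}, where p' = p/(p−1) for p ∈ (1,∞) and p' = ∞ for p = 1; (2) if p = ∞, q = 1, and ∫₀¹ t^{−1} b(t) dt < ∞, then (L^{∞,1,b})' = L^{(1,∞,b̃^{−1})}, where b̃(t) = ∫₀ᵗ s^{−1} b(s) ds. -/

import Mathlib

open MeasureTheory Set Filter ENNReal Topology

noncomputable section

/-- `f ≈ g` on `S`: two-sided equivalence with positive constants. -/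
def EquivOn (f g : ℝ → ℝ) (S : Set ℝ) : Prop :=
  ∃ c C : ℝ, 0 < c ∧ 0 < C ∧ ∀ t ∈ S, c * g t ≤ f t ∧ f t ≤ C * g t

/-- A measurable positive function on `(0,∞)` is slowly varying if for every `ε > 0`,
`t ^ ε * b t` is equivalent to a non-decreasing function and `t ^ (-ε) * b t` is
equivalent to a non-increasing function on `(0,∞)`. -/
def IsSlowlyVarying (b : ℝ → ℝ) : Prop :=
  Measurable b ∧ (∀ t ∈ Set.Ioi (0:ℝ), 0 < b t) ∧
    ∀ ε : ℝ, 0 < ε →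
      (∃ bp : ℝ → ℝ, MonotoneOn bp (Set.Ioi 0) ∧
        EquivOn (fun t => t ^ ε * b t) bp (Set.Ioi 0)) ∧
      (∃ bm : ℝ → ℝ, AntitoneOn bm (Set.Ioi 0) ∧
        EquivOn (fun t => t ^ (-ε) * b t) bm (Set.Ioi 0))

/-- The non-increasing rearrangement `f*` (with values in `ℝ≥0∞`). -/
def rearr {X : Type*} [MeasurableSpace X] (μ : Measure X) (f : X → ℝ) (t : ℝ) : ℝ≥0∞ :=
  sInf {s : ℝ≥0∞ | μ {x | s < ENNReal.ofReal |f x|} ≤ ENNReal.ofReal t}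

/-- The maximal function `f**(t) = (1/t) ∫₀ᵗ f*`. -/
def maxf {X : Type*} [MeasurableSpace X] (μ : Measure X) (f : X → ℝ) (t : ℝ) : ℝ≥0∞ :=
  (ENNReal.ofReal t)⁻¹ * ∫⁻ s in Set.Ioo (0:ℝ) t, rearr μ f s

/-- The `L^q` "norm" over a subset `S ⊆ ℝ` of an `ℝ≥0∞`-valued function. -/
def lqNorm (q : ℝ≥0∞) (S : Set ℝ) (g : ℝ → ℝ≥0∞) : ℝ≥0∞ :=
  if q = ∞ then essSup g (volume.restrict S)
  else (∫⁻ t in S, g t ^ q.toReal) ^ (1 / q.toReal)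

/-- The Lorentz–Karamata functional `‖f‖_{p,q,b}`. -/
def lkNorm {X : Type*} [MeasurableSpace X] (μ : Measure X) (p q : ℝ≥0∞) (b : ℝ → ℝ)
    (f : X → ℝ) : ℝ≥0∞ :=
  lqNorm q (Set.Ioi 0)
    (fun t => ENNReal.ofReal (t ^ (p⁻¹.toReal - q⁻¹.toReal) * b t) * rearr μ f t)

/-- The Lorentz–Karamata functional `‖f‖_{(p,q,b)}` defined via the maximal function. -/
def lkMaxNorm {X : Type*} [MeasurableSpace X] (μ : Measure X) (p q : ℝ≥0∞) (b : ℝ → ℝ)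
    (f : X → ℝ) : ℝ≥0∞ :=
  lqNorm q (Set.Ioi 0)
    (fun t => ENNReal.ofReal (t ^ (p⁻¹.toReal - q⁻¹.toReal) * b t) * maxf μ f t)

/-- The `L^q(0,∞)` norm of `t ^ (1/p - 1/q) * b t` restricted to `S`. -/
def weightNorm (p q : ℝ≥0∞) (b : ℝ → ℝ) (S : Set ℝ) : ℝ≥0∞ :=
  lqNorm q S (fun t => ENNReal.ofReal (t ^ (p⁻¹.toReal - q⁻¹.toReal) * b t))

/-- A measure is non-atomic. -/
def IsNonatomic {X : Type*} [MeasurableSpace X] (μ : Measure X) : Prop :=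
  ∀ s : Set X, MeasurableSet s → 0 < μ s →
    ∃ t, t ⊆ s ∧ MeasurableSet t ∧ 0 < μ t ∧ μ t < μ s

/-- `b̃(t) = ∫₀ᵗ s⁻¹ b(s) ds`. -/
def svTilde (b : ℝ → ℝ) (t : ℝ) : ℝ≥0∞ :=
  ∫⁻ s in Set.Ioo (0:ℝ) t, ENNReal.ofReal (s⁻¹ * b s)

/-- `b̃_∞(t) = esssup_{s ∈ (0,t)} b(s)`. -/
def svTildeSup (b : ℝ → ℝ) (t : ℝ) : ℝ≥0∞ :=
  essSup (fun s => ENNReal.ofReal (b s)) (volume.restrict (Set.Ioo (0:ℝ) t))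

/-- `b̂(t) = ∫_t^∞ s⁻¹ b(s) ds`. -/
def svHat (b : ℝ → ℝ) (t : ℝ) : ℝ≥0∞ :=
  ∫⁻ s in Set.Ioi t, ENNReal.ofReal (s⁻¹ * b s)

/-- `b̂_∞(t) = esssup_{s ∈ (t,∞)} b(s)`. -/
def svHatSup (b : ℝ → ℝ) (t : ℝ) : ℝ≥0∞ :=
  essSup (fun s => ENNReal.ofReal (b s)) (volume.restrict (Set.Ioi t))

/-- The associate functional of a functional `N`. -/
def assocNorm {X : Type*} [MeasurableSpace X] (μ : Measure X) (N : (X → ℝ) → ℝ≥0∞)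
    (f : X → ℝ) : ℝ≥0∞ :=
  ⨆ (g : X → ℝ) (_ : Measurable g) (_ : N g ≤ 1), ∫⁻ x, ENNReal.ofReal |f x * g x| ∂μ

/-- The conjugate exponent: `q' = q/(q-1)` for `q ∈ (1,∞)`, `1' = ∞`, `∞' = 1`. -/
def conjE (q : ℝ≥0∞) : ℝ≥0∞ := (1 - q⁻¹)⁻¹

/-- The interval `(0, μ(R))` inside `ℝ`, where `μ(R)` may be infinite. -/
def IooMu {X : Type*} [MeasurableSpace X] (μ : Measure X) : Set ℝ :=
  {t : ℝ | 0 < t ∧ ENNReal.ofReal t < μ Set.univ}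

/-- The embedding `L^{p₁,q₁,b₁} ↪ L^{p₂,q₂,b₂}`. -/
def lkEmbed {X : Type*} [MeasurableSpace X] (μ : Measure X) (p1 q1 : ℝ≥0∞) (b1 : ℝ → ℝ)
    (p2 q2 : ℝ≥0∞) (b2 : ℝ → ℝ) : Prop :=
  ∃ C : ℝ≥0∞, C < ∞ ∧ ∀ f : X → ℝ, Measurable f →
    lkNorm μ p2 q2 b2 f ≤ C * lkNorm μ p1 q1 b1 f

/-- A rearrangement-invariant quasi-Banach function norm. -/
structure IsRIQuasiBFN {X : Type*} [MeasurableSpace X] (μ : Measure X)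
    (N : (X → ℝ) → ℝ≥0∞) : Prop where
  abs_eq : ∀ f : X → ℝ, Measurable f → N (fun x => |f x|) = N f
  smul : ∀ (a : ℝ) (f : X → ℝ), Measurable f →
    N (fun x => a * f x) = ENNReal.ofReal |a| * N f
  eq_zero_iff : ∀ f : X → ℝ, Measurable f → (N f = 0 ↔ f =ᵐ[μ] 0)
  quasi_add : ∃ C : ℝ≥0∞, C < ∞ ∧ ∀ f g : X → ℝ, Measurable f → Measurable g →
    N (fun x => f x + g x) ≤ C * (N f + N g)
  mono : ∀ f g : X → ℝ, Measurable f → Measurable g →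
    (∀ᵐ x ∂μ, |f x| ≤ |g x|) → N f ≤ N g
  fatou : ∀ (f : ℕ → X → ℝ) (g : X → ℝ), (∀ n, Measurable (f n)) → Measurable g →
    (∀ᵐ x ∂μ, ∀ n, 0 ≤ f n x) → (∀ᵐ x ∂μ, Monotone fun n => f n x) →
    (∀ᵐ x ∂μ, Filter.Tendsto (fun n => f n x) Filter.atTop (nhds (g x))) →
    N g = ⨆ n, N (f n)
  ind_lt_top : ∀ E : Set X, MeasurableSet E → μ E < ∞ →
    N (Set.indicator E fun _ => (1:ℝ)) < ∞
  rearr_inv : ∀ f g : X → ℝ, Measurable f → Measurable g →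
    rearr μ f = rearr μ g → N f = N g

/-- A rearrangement-invariant Banach function norm. -/
structure IsRIBFN {X : Type*} [MeasurableSpace X] (μ : Measure X)
    (N : (X → ℝ) → ℝ≥0∞) : Prop where
  abs_eq : ∀ f : X → ℝ, Measurable f → N (fun x => |f x|) = N f
  smul : ∀ (a : ℝ) (f : X → ℝ), Measurable f →
    N (fun x => a * f x) = ENNReal.ofReal |a| * N f
  eq_zero_iff : ∀ f : X → ℝ, Measurable f → (N f = 0 ↔ f =ᵐ[μ] 0)
  add_le : ∀ f g : X → ℝ, Measurable f → Measurable g →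
    N (fun x => f x + g x) ≤ N f + N g
  mono : ∀ f g : X → ℝ, Measurable f → Measurable g →
    (∀ᵐ x ∂μ, |f x| ≤ |g x|) → N f ≤ N g
  fatou : ∀ (f : ℕ → X → ℝ) (g : X → ℝ), (∀ n, Measurable (f n)) → Measurable g →
    (∀ᵐ x ∂μ, ∀ n, 0 ≤ f n x) → (∀ᵐ x ∂μ, Monotone fun n => f n x) →
    (∀ᵐ x ∂μ, Filter.Tendsto (fun n => f n x) Filter.atTop (nhds (g x))) →
    N g = ⨆ n, N (f n)
  ind_lt_top : ∀ E : Set X, MeasurableSet E → μ E < ∞ →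
    N (Set.indicator E fun _ => (1:ℝ)) < ∞
  integral_le : ∀ E : Set X, MeasurableSet E → μ E < ∞ →
    ∃ C : ℝ≥0∞, C < ∞ ∧ ∀ f : X → ℝ, Measurable f →
      ∫⁻ x in E, ENNReal.ofReal |f x| ∂μ ≤ C * N f
  rearr_inv : ∀ f g : X → ℝ, Measurable f → Measurable g →
    rearr μ f = rearr μ g → N f = N g

end

theorem measurableSet_lt_abs {X : Type*} [MeasurableSpace X] {f : X → ℝ} (hf : Measurable f)
    (l : ℝ≥0∞) : MeasurableSet {x | l < ENNReal.ofReal |f x|} :=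
  measurableSet_lt measurable_const hf.abs.ennreal_ofReal

theorem lt_rearr_iff {X : Type*} [MeasurableSpace X] (μ : Measure X) (f : X → ℝ) (t : ℝ)
    (l : ℝ≥0∞) :
    l < rearr μ f t ↔ ENNReal.ofReal t < μ {x | l < ENNReal.ofReal |f x|} := by
  refine ⟨fun h => ?_, fun h => ?_⟩
  · by_contra! hle
    exact absurd (sInf_le (show l ∈ {s : ℝ≥0∞ | μ {x | s < ENNReal.ofReal |f x|} ≤
      ENNReal.ofReal t} from hle)) (not_le.2 h)
  · by_contra! hle
    refine absurd h (not_lt.2 ?_)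
    rcases eq_or_ne l ∞ with rfl | hl
    · simp
    obtain ⟨u, hu, hul, hlim⟩ := exists_seq_strictAnti_tendsto' (lt_top_iff_ne_top.2 hl)
    have hset : {x | l < ENNReal.ofReal |f x|} = ⋃ n, {x | u n < ENNReal.ofReal |f x|} := by
      ext x
      simp only [mem_ofPred_eq, mem_iUnion]
      refine ⟨fun hx => ?_, fun ⟨n, hn⟩ => (hul n).1.trans hn⟩
      exact ((tendsto_order.1 hlim).2 _ hx).exists
    have hmono : Monotone fun n => {x | u n < ENNReal.ofReal |f x|} :=
      fun m n hmn x hx => lt_of_le_of_lt (hu.antitone hmn) hx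
    rw [hset, hmono.measure_iUnion]
    refine iSup_le fun n => ?_
    obtain ⟨s, hs, hsu⟩ := sInf_lt_iff.1 (lt_of_le_of_lt hle (hul n).1)
    exact le_trans (measure_mono fun x hx => lt_trans hsu hx) hs

theorem rearr_antitone {X : Type*} [MeasurableSpace X] (μ : Measure X) (f : X → ℝ) :
    Antitone (rearr μ f) := fun _ _ hst =>
  sInf_le_sInf fun _ hr => le_trans hr (ENNReal.ofReal_le_ofReal hst)

theorem measurable_rearr {X : Type*} [MeasurableSpace X] (μ : Measure X) (f : X → ℝ) :
    Measurable (rearr μ f) := (rearr_antitone μ f).measurable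

theorem rearr_indicator_le {X : Type*} [MeasurableSpace X] (μ : Measure X) (E : Set X) {a : ℝ}
    (ha : 0 ≤ a) {t : ℝ} (hE : μ E ≤ ENNReal.ofReal t) (s : ℝ) :
    rearr μ (E.indicator fun _ => a) s ≤ (Iio t).indicator (fun _ => ENNReal.ofReal a) s := by
  refine sInf_le ?_
  simp only [mem_ofPred_eq]
  by_cases hs : s < t
  · rw [indicator_of_mem (show s ∈ Iio t from hs)]
    refine le_of_eq_of_le (measure_mono_null (t := ∅) (fun x hx => ?_) measure_empty) (zero_le)
    refine absurd hx (not_lt.2 (ENNReal.ofReal_le_ofReal ?_))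
    by_cases hxE : x ∈ E <;> simp [hxE, abs_of_nonneg ha, ha]
  · rw [indicator_of_notMem (show s ∉ Iio t from hs)]
    refine le_trans (measure_mono fun x hx => ?_) (hE.trans (ENNReal.ofReal_le_ofReal (not_lt.1 hs)))
    by_contra hxE
    simp [hxE] at hx

/-- The points of `(0, m)`, for an extended length `m`. -/
def IooENN (m : ℝ≥0∞) : Set ℝ := {s : ℝ | 0 < s ∧ ENNReal.ofReal s < m}

theorem measurableSet_IooENN (m : ℝ≥0∞) : MeasurableSet (IooENN m) :=
  measurableSet_Ioi.inter (measurableSet_lt ENNReal.measurable_ofReal measurable_const)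

theorem IooENN_ofReal (t : ℝ) : IooENN (ENNReal.ofReal t) = Ioo 0 t := by
  ext s
  simp only [IooENN, mem_ofPred_eq, mem_Ioo]
  exact ⟨fun h => ⟨h.1, (ENNReal.ofReal_lt_ofReal_iff_of_nonneg h.1.le).1 h.2⟩,
    fun h => ⟨h.1, (ENNReal.ofReal_lt_ofReal_iff_of_nonneg h.1.le).2 h.2⟩⟩

theorem volume_IooENN (m : ℝ≥0∞) : volume (IooENN m) = m := by
  rcases eq_or_ne m ∞ with rfl | hm
  · have : IooENN ∞ = Ioi 0 := by ext s; simp [IooENN]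
    rw [this, Real.volume_Ioi]
  · rw [← ENNReal.ofReal_toReal hm, IooENN_ofReal, Real.volume_Ioo, sub_zero]

theorem setLIntegral_IooENN_le {F w : ℝ → ℝ≥0∞} (M : ℝ≥0∞)
    (h : ∀ᵐ t ∂volume.restrict (Ioi (0:ℝ)),
      ∫⁻ s in Ioo (0:ℝ) t, F s ≤ M * ∫⁻ s in Ioo (0:ℝ) t, w s) (m : ℝ≥0∞) :
    ∫⁻ s in IooENN m, F s ≤ M * ∫⁻ s in IooENN m, w s := by
  rcases eq_or_ne m 0 with rfl | hm
  · simp [IooENN]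
  obtain ⟨u, hu, hum, hlim⟩ := exists_seq_strictMono_tendsto' (pos_iff_ne_zero.2 hm)
  have hset : IooENN m = ⋃ n, IooENN (u n) := by
    ext x
    simp only [IooENN, mem_ofPred_eq, mem_iUnion]
    refine ⟨fun hx => ?_, fun ⟨n, hn⟩ => ⟨hn.1, hn.2.trans (hum n).2⟩⟩
    obtain ⟨n, hn⟩ := ((tendsto_order.1 hlim).1 _ hx.2).exists
    exact ⟨n, hx.1, hn⟩
  have hmono : Monotone fun n => IooENN (u n) :=
    fun a c hac x hx => ⟨hx.1, hx.2.trans_le (hu.monotone hac)⟩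
  conv_lhs => rw [hset]
  rw [setLIntegral_iUnion_of_directed _ hmono.directed_le]
  refine iSup_le fun n => ?_
  obtain ⟨r, hr1, hr2⟩ := ENNReal.lt_iff_exists_real_btwn.1 (hum n).2 |>.imp fun r hr => hr.2
  obtain ⟨r', hr1', hr2'⟩ := ENNReal.lt_iff_exists_real_btwn.1 hr2 |>.imp fun r hr => hr.2
  have hr0 : 0 < r := ENNReal.ofReal_pos.1 ((zero_le).trans_lt hr1)
  have hrr : r < r' := (ENNReal.ofReal_lt_ofReal_iff_of_nonneg hr0.le).1 hr1'
  obtain ⟨t, ht, htF⟩ : ∃ t ∈ Ioo r r',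
      ∫⁻ s in Ioo (0:ℝ) t, F s ≤ M * ∫⁻ s in Ioo (0:ℝ) t, w s := by
    by_contra! hcon
    rw [ae_restrict_iff' measurableSet_Ioi] at h
    have h0 : volume (Ioo r r') = 0 := by
      refine measure_mono_null (fun t ht => ?_) h
      simp only [mem_compl_iff, mem_ofPred_eq, Classical.not_imp, not_le]
      exact ⟨hr0.trans ht.1, hcon t ht⟩
    rw [Real.volume_Ioo, ENNReal.ofReal_eq_zero] at h0
    linarith
  calc ∫⁻ s in IooENN (u n), F s ≤ ∫⁻ s in Ioo 0 t, F s := by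
        rw [← IooENN_ofReal]
        refine lintegral_mono_set fun s hs => ⟨hs.1, hs.2.trans (hr1.trans ?_)⟩
        exact (ENNReal.ofReal_lt_ofReal_iff_of_nonneg hr0.le).2 ht.1
    _ ≤ M * ∫⁻ s in Ioo 0 t, w s := htF
    _ ≤ M * ∫⁻ s in IooENN m, w s := by
        gcongr
        rw [← IooENN_ofReal]
        refine fun s hs => ⟨hs.1, hs.2.trans (lt_of_le_of_lt ?_ hr2')⟩
        exact ENNReal.ofReal_le_ofReal ht.2.le

/-- Layer cake formula for extended nonnegative functions. -/
theorem lintegral_eq_lintegral_meas_ofReal_lt {α : Type*} [MeasurableSpace α] (ν : Measure α)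
    [SFinite ν] {g : α → ℝ≥0∞} (hg : Measurable g) :
    ∫⁻ a, g a ∂ν = ∫⁻ t in Ioi (0:ℝ), ν {a | ENNReal.ofReal t < g a} := by
  have hms : MeasurableSet {z : ℝ × α | ENNReal.ofReal z.1 < g z.2} :=
    measurableSet_lt (ENNReal.measurable_ofReal.comp measurable_fst) (hg.comp measurable_snd)
  have h1 : ∀ a, g a = ∫⁻ t in Ioi (0:ℝ),
      {z : ℝ × α | ENNReal.ofReal z.1 < g z.2}.indicator 1 (t, a) := fun a => by
    have : ∀ t, {z : ℝ × α | ENNReal.ofReal z.1 < g z.2}.indicator (1 : ℝ × α → ℝ≥0∞) (t, a) =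
        {t | ENNReal.ofReal t < g a}.indicator 1 t := fun t => rfl
    simp_rw [this]
    rw [lintegral_indicator_one (measurableSet_lt ENNReal.measurable_ofReal measurable_const),
      Measure.restrict_apply (measurableSet_lt ENNReal.measurable_ofReal measurable_const),
      inter_comm]
    exact (volume_IooENN _).symm
  have h2 : ∀ t : ℝ, ν {a | ENNReal.ofReal t < g a} =
      ∫⁻ a, {z : ℝ × α | ENNReal.ofReal z.1 < g z.2}.indicator 1 (t, a) ∂ν := fun t => by
    rw [← lintegral_indicator_one (measurableSet_lt measurable_const hg)]
    rfl
  simp_rw [h2]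
  rw [lintegral_lintegral_swap]
  · exact lintegral_congr h1
  · exact (measurable_one.indicator hms).aemeasurable

theorem setLIntegral_abs_le_rearr {X : Type*} [MeasurableSpace X] (μ : Measure X) [SigmaFinite μ]
    {f : X → ℝ} (hf : Measurable f) (E : Set X) :
    ∫⁻ x in E, ENNReal.ofReal |f x| ∂μ ≤ ∫⁻ s in IooENN (μ E), rearr μ f s := by
  rw [lintegral_eq_lintegral_meas_ofReal_lt _ hf.abs.ennreal_ofReal,
    lintegral_eq_lintegral_meas_ofReal_lt _ (measurable_rearr μ f)]
  refine lintegral_mono fun t => ?_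
  have hset : {s | ENNReal.ofReal t < rearr μ f s} ∩ IooENN (μ E) =
      IooENN (min (μ E) (μ {x | ENNReal.ofReal t < ENNReal.ofReal |f x|})) := by
    ext s
    simp only [mem_inter_iff, mem_ofPred_eq, lt_rearr_iff, IooENN, lt_min_iff]
    tauto
  rw [Measure.restrict_apply (measurableSet_lt measurable_const (measurable_rearr μ f)), hset,
    volume_IooENN, Measure.restrict_apply (measurableSet_lt_abs hf _)]
  exact le_min (measure_mono inter_subset_right) (measure_mono inter_subset_left)

theorem lintegral_rearr {X : Type*} [MeasurableSpace X] (μ : Measure X) [SigmaFinite μ]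
    {f : X → ℝ} (hf : Measurable f) :
    ∫⁻ s in Ioi (0:ℝ), rearr μ f s = ∫⁻ x, ENNReal.ofReal |f x| ∂μ := by
  rw [lintegral_eq_lintegral_meas_ofReal_lt _ hf.abs.ennreal_ofReal,
    lintegral_eq_lintegral_meas_ofReal_lt _ (measurable_rearr μ f)]
  refine lintegral_congr fun t => ?_
  rw [Measure.restrict_apply (measurableSet_lt measurable_const (measurable_rearr μ f)),
    inter_comm]
  simp only [lt_rearr_iff]
  exact volume_IooENN _

/-- A form of the Hardy-Littlewood inequality combined with Hardy's lemma. -/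
theorem lintegral_abs_mul_le {X : Type*} [MeasurableSpace X] (μ : Measure X) [SigmaFinite μ]
    {f g : X → ℝ} (hf : Measurable f) (hg : Measurable g) {w : ℝ → ℝ≥0∞} (hw : Measurable w)
    (M : ℝ≥0∞) (h : ∀ᵐ t ∂volume.restrict (Ioi (0:ℝ)),
      ∫⁻ s in Ioo (0:ℝ) t, rearr μ f s ≤ M * ∫⁻ s in Ioo (0:ℝ) t, w s) :
    ∫⁻ x, ENNReal.ofReal |f x * g x| ∂μ ≤ M * ∫⁻ s in Ioi (0:ℝ), w s * rearr μ g s := by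
  have hf' : Measurable fun x => ENNReal.ofReal |f x| := hf.abs.ennreal_ofReal
  have hg' : Measurable fun x => ENNReal.ofReal |g x| := hg.abs.ennreal_ofReal
  have h1 : ∫⁻ x, ENNReal.ofReal |f x * g x| ∂μ =
      ∫⁻ t in Ioi (0:ℝ), ∫⁻ x in {x | ENNReal.ofReal t < ENNReal.ofReal |g x|},
        ENNReal.ofReal |f x| ∂μ := by
    simp_rw [abs_mul, ENNReal.ofReal_mul (abs_nonneg _)]
    have := lintegral_withDensity_eq_lintegral_mul μ hf' hg'
    simp only [Pi.mul_apply] at this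
    rw [← this, lintegral_eq_lintegral_meas_ofReal_lt _ hg']
    exact lintegral_congr fun t => withDensity_apply _ (measurableSet_lt_abs hg _)
  have h2 : ∫⁻ s in Ioi (0:ℝ), w s * rearr μ g s =
      ∫⁻ t in Ioi (0:ℝ), ∫⁻ s in IooENN (μ {x | ENNReal.ofReal t < ENNReal.ofReal |g x|}),
        w s := by
    have := lintegral_withDensity_eq_lintegral_mul (volume.restrict (Ioi (0:ℝ))) hw
      (measurable_rearr μ g)
    simp only [Pi.mul_apply] at this
    rw [← this, lintegral_eq_lintegral_meas_ofReal_lt _ (measurable_rearr μ g)]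
    refine lintegral_congr fun t => ?_
    have hm := measurableSet_lt (measurable_const (a := ENNReal.ofReal t)) (measurable_rearr μ g)
    rw [withDensity_apply _ hm, Measure.restrict_restrict hm, inter_comm]
    simp only [lt_rearr_iff]
    rfl
  have hanti : Antitone fun t : ℝ =>
      ∫⁻ s in IooENN (μ {x | ENNReal.ofReal t < ENNReal.ofReal |g x|}), w s := fun a c hac =>
    lintegral_mono_set fun s hs => ⟨hs.1, hs.2.trans_le (measure_mono fun x hx =>
      lt_of_le_of_lt (ENNReal.ofReal_le_ofReal hac) hx)⟩
  rw [h1, h2, ← lintegral_const_mul _ hanti.measurable]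
  exact lintegral_mono fun t => (setLIntegral_abs_le_rearr μ hf _).trans
    (setLIntegral_IooENN_le M h _)

theorem IsNonatomic.exists_subset_pos_le {X : Type*} [MeasurableSpace X] {μ : Measure X}
    [SigmaFinite μ] (hna : IsNonatomic μ) {s : Set X} (hs : MeasurableSet s) (hs0 : 0 < μ s)
    {ε : ℝ≥0∞} (hε : 0 < ε) : ∃ t ⊆ s, MeasurableSet t ∧ 0 < μ t ∧ μ t ≤ ε := by
  obtain ⟨s', hs'm, hs's, hs'0, hs'top⟩ := Measure.exists_subset_measure_lt_top hs hs0
  have key : ∀ n : ℕ, ∃ t ⊆ s', MeasurableSet t ∧ 0 < μ t ∧ 2 ^ n * μ t ≤ μ s' := by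
    intro n
    induction n with
    | zero => exact ⟨s', Subset.rfl, hs'm, hs'0, by simp⟩
    | succ n ih =>
      obtain ⟨t, hts, htm, ht0, hle⟩ := ih
      obtain ⟨u, hut, hum, hu0, hult⟩ := hna t htm ht0
      have hadd : μ u + μ (t \ u) = μ t := by
        rw [measure_add_sdiff hum.nullMeasurableSet, union_eq_self_of_subset_left hut]
      have hd0 : 0 < μ (t \ u) := by
        rw [pos_iff_ne_zero]
        intro h0
        rw [h0, add_zero] at hadd
        exact hult.ne hadd
      rcases le_total (μ u) (μ (t \ u)) with h | h
      · refine ⟨u, hut.trans hts, hum, hu0, le_trans ?_ hle⟩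
        rw [pow_succ, mul_assoc, two_mul, ← hadd]
        gcongr
      · refine ⟨t \ u, sdiff_subset.trans hts, htm.diff hum, hd0, le_trans ?_ hle⟩
        rw [pow_succ, mul_assoc, two_mul, ← hadd]
        gcongr
  have hlim : Tendsto (fun n : ℕ => ε * 2 ^ n) atTop (𝓝 ∞) := by
    have h2 : Tendsto (fun n : ℕ => (2:ℝ≥0∞) ^ n) atTop (𝓝 ∞) :=
      ENNReal.tendsto_pow_atTop_nhds_top_iff.2 (by norm_num)
    have := ENNReal.Tendsto.const_mul (a := ε) h2 (Or.inl (by simp))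
    rwa [ENNReal.mul_top hε.ne'] at this
  obtain ⟨n, hn⟩ := ((tendsto_order.1 hlim).1 _ hs'top).exists
  obtain ⟨t, hts, htm, ht0, hle⟩ := key n
  refine ⟨t, hts.trans hs's, htm, ht0, ?_⟩
  by_contra! hlt
  refine absurd hn (not_lt.2 (le_trans ?_ hle))
  rw [mul_comm]
  gcongr

/-- Sierpinski's theorem: a non-atomic measure takes all intermediate values. -/
theorem IsNonatomic.exists_subset_measure_eq {X : Type*} [MeasurableSpace X] {μ : Measure X}
    [SigmaFinite μ] (hna : IsNonatomic μ) {B : Set X} (hB : MeasurableSet B) {t : ℝ≥0∞}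
    (ht : t < μ B) : ∃ E ⊆ B, MeasurableSet E ∧ μ E = t := by
  let S := {E : Set X // MeasurableSet E ∧ E ⊆ B ∧ μ E ≤ t}
  have hstep : ∀ (n : ℕ) (E : S), ∃ E' : S, E.1 ⊆ E'.1 ∧
      ∀ E'' : S, E.1 ⊆ E''.1 → μ E''.1 ≤ μ E'.1 + ((n : ℝ≥0∞) + 1)⁻¹ := by
    intro n E
    by_contra! hcon
    have hpos : (0 : ℝ≥0∞) < ((n : ℝ≥0∞) + 1)⁻¹ :=
      ENNReal.inv_pos.2 (by finiteness)
    have hiter : ∀ k : ℕ, ∃ E' : S, E.1 ⊆ E'.1 ∧ k * ((n : ℝ≥0∞) + 1)⁻¹ ≤ μ E'.1 := by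
      intro k
      induction k with
      | zero => exact ⟨E, Subset.rfl, by simp⟩
      | succ k ih =>
        obtain ⟨E', hE', hk⟩ := ih
        obtain ⟨E'', h1, h2⟩ := hcon E' hE'
        refine ⟨E'', h1, le_trans ?_ h2.le⟩
        push_cast
        rw [add_mul, one_mul]
        gcongr
    obtain ⟨k, hk⟩ := ENNReal.exists_nat_mul_gt hpos.ne' ht.ne_top
    obtain ⟨E', -, hE'⟩ := hiter k
    exact absurd hk (not_lt.2 (hE'.trans E'.2.2.2))
  choose next hsub hmax using hstep
  let u : ℕ → S := fun n => Nat.rec ⟨∅, MeasurableSet.empty, empty_subset _, by simp⟩ next n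
  have hu : ∀ n, u (n + 1) = next n (u n) := fun n => rfl
  have humono : Monotone fun n => (u n).1 := monotone_nat_of_le_succ fun n => by
    rw [hu]; exact hsub n (u n)
  have hE : MeasurableSet (⋃ n, (u n).1) := MeasurableSet.iUnion fun n => (u n).2.1
  have hEt : μ (⋃ n, (u n).1) ≤ t := by
    rw [humono.measure_iUnion]
    exact iSup_le fun n => (u n).2.2.2
  have hEB : (⋃ n, (u n).1) ⊆ B := iUnion_subset fun n => (u n).2.2.1
  refine ⟨⋃ n, (u n).1, hEB, hE, hEt.antisymm ?_⟩
  by_contra! hlt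
  have hdiff : 0 < μ (B \ ⋃ n, (u n).1) := by
    rw [pos_iff_ne_zero]
    intro h0
    refine absurd ht (not_lt.2 (le_trans ?_ hEt))
    exact measure_mono_ae (ae_le_set.2 h0)
  obtain ⟨D, hDs, hDm, hD0, hDle⟩ := hna.exists_subset_pos_le (hB.diff hE) hdiff
    (tsub_pos_iff_lt.2 hlt)
  have hdisj : Disjoint (⋃ n, (u n).1) D := disjoint_sdiff_right.mono_right hDs
  have hmu : μ ((⋃ n, (u n).1) ∪ D) = μ (⋃ n, (u n).1) + μ D := measure_union hdisj hDm
  have hV : μ ((⋃ n, (u n).1) ∪ D) ≤ t := by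
    refine hmu.le.trans (le_trans ?_ (add_tsub_cancel_of_le hEt).le)
    gcongr
  obtain ⟨n, hn⟩ := ENNReal.exists_inv_nat_lt hD0.ne'
  have h1 := hmax n (u n) ⟨(⋃ n, (u n).1) ∪ D, hE.union hDm,
    union_subset hEB (hDs.trans sdiff_subset), hV⟩
    ((subset_iUnion (fun n => (u n).1) n).trans subset_union_left)
  rw [← hu] at h1
  have h2 : μ (⋃ n, (u n).1) + μ D ≤ μ (⋃ n, (u n).1) + ((n : ℝ≥0∞) + 1)⁻¹ := by
    rw [← hmu]
    refine h1.trans ?_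
    gcongr
    exact subset_iUnion (fun n => (u n).1) (n + 1)
  have h3 := (ENNReal.add_le_add_iff_left (hlt.trans_le le_top).ne).1 h2
  refine absurd h3 (not_le.2 (lt_of_le_of_lt ?_ hn))
  exact ENNReal.inv_le_inv.2 le_self_add

theorem lintegral_rearr_Ioo_le {X : Type*} [MeasurableSpace X] (μ : Measure X) [SigmaFinite μ]
    {f : X → ℝ} (hf : Measurable f) {t : ℝ} :
    ∫⁻ s in Ioo (0:ℝ) t, rearr μ f s ≤ ENNReal.ofReal t * rearr μ f t +
      ∫⁻ x in {x | rearr μ f t < ENNReal.ofReal |f x|}, ENNReal.ofReal |f x| ∂μ := by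
  have hA := measurableSet_lt_abs hf (rearr μ f t)
  set A := {x | rearr μ f t < ENNReal.ofReal |f x|} with hAdef
  have hle : ∀ s, rearr μ f s ≤ rearr μ f t + rearr μ (A.indicator f) s := by
    intro s
    by_contra! hlt
    obtain ⟨l, hl1, hl2⟩ := exists_between hlt
    rw [lt_rearr_iff] at hl2
    have hls : rearr μ (A.indicator f) s < l := lt_of_le_of_lt le_add_self hl1
    have hlt' : rearr μ f t < l := lt_of_le_of_lt le_self_add hl1
    refine absurd (hl2.trans_le (measure_mono fun x hx => ?_))
      (fun h => absurd ((lt_rearr_iff μ (A.indicator f) s l).2 h) (not_lt.2 hls.le))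
    have hxA : x ∈ A := hlt'.trans hx
    simp only [mem_ofPred_eq, indicator_of_mem hxA]
    exact hx
  calc ∫⁻ s in Ioo (0:ℝ) t, rearr μ f s
      ≤ ∫⁻ s in Ioo (0:ℝ) t, (rearr μ f t + rearr μ (A.indicator f) s) :=
        lintegral_mono fun s => hle s
    _ = ENNReal.ofReal t * rearr μ f t + ∫⁻ s in Ioo (0:ℝ) t, rearr μ (A.indicator f) s := by
        rw [lintegral_add_left measurable_const, setLIntegral_const, Real.volume_Ioo, sub_zero,
          mul_comm]
    _ ≤ ENNReal.ofReal t * rearr μ f t + ∫⁻ s in Ioi (0:ℝ), rearr μ (A.indicator f) s := by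
        gcongr
        exact Ioo_subset_Ioi_self
    _ = _ := by
        rw [lintegral_rearr μ (hf.indicator hA), ← lintegral_indicator hA]
        congr 2
        ext x
        by_cases hx : x ∈ A <;> simp [hx]

/-- Testing on indicator functions bounds the associate functional from below. -/
theorem lintegral_rearr_le_assocNorm {X : Type*} [MeasurableSpace X] {μ : Measure X}
    [SigmaFinite μ] (hna : IsNonatomic μ) (N : (X → ℝ) → ℝ≥0∞) {K t : ℝ} (hK : 0 < K)
    (hN : ∀ E : Set X, MeasurableSet E → μ E ≤ ENNReal.ofReal t →
      N (E.indicator fun _ => K⁻¹) ≤ 1) {f : X → ℝ} (hf : Measurable f) :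
    ∫⁻ s in Ioo (0:ℝ) t, rearr μ f s ≤ 2 * ENNReal.ofReal K * assocNorm μ N f := by
  have hE : ∀ E : Set X, MeasurableSet E → μ E ≤ ENNReal.ofReal t →
      ∫⁻ x in E, ENNReal.ofReal |f x| ∂μ ≤ ENNReal.ofReal K * assocNorm μ N f := by
    intro E hEm hEt
    have h1 : ∫⁻ x, ENNReal.ofReal |f x * E.indicator (fun _ => K⁻¹) x| ∂μ ≤ assocNorm μ N f :=
      le_iSup_of_le (E.indicator fun _ => K⁻¹) (le_iSup_of_le (measurable_const.indicator hEm)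
        (le_iSup_of_le (hN E hEm hEt) le_rfl))
    have h2 : ∫⁻ x, ENNReal.ofReal |f x * E.indicator (fun _ => K⁻¹) x| ∂μ =
        ENNReal.ofReal K⁻¹ * ∫⁻ x in E, ENNReal.ofReal |f x| ∂μ := by
      rw [← lintegral_const_mul _ hf.abs.ennreal_ofReal, ← lintegral_indicator hEm]
      refine lintegral_congr fun x => ?_
      by_cases hx : x ∈ E
      · simp only [hx, indicator_of_mem]
        rw [abs_mul, mul_comm, ENNReal.ofReal_mul (abs_nonneg _), abs_of_pos (inv_pos.2 hK)]
      · simp [hx]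
    rw [h2] at h1
    calc ∫⁻ x in E, ENNReal.ofReal |f x| ∂μ
        = ENNReal.ofReal K * (ENNReal.ofReal K⁻¹ * ∫⁻ x in E, ENNReal.ofReal |f x| ∂μ) := by
          rw [← mul_assoc, ← ENNReal.ofReal_mul hK.le, mul_inv_cancel₀ hK.ne', ENNReal.ofReal_one,
            one_mul]
      _ ≤ _ := by gcongr
  refine (lintegral_rearr_Ioo_le μ hf).trans ?_
  rw [mul_assoc, two_mul]
  refine add_le_add ?_ ?_
  · rcases eq_or_ne (ENNReal.ofReal t) 0 with h0 | h0
    · simp [h0]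
    rw [mul_comm]
    refine ENNReal.mul_le_of_le_div (le_of_forall_lt fun l hl => ?_)
    obtain ⟨l', hll', hl'⟩ := exists_between hl
    refine hll'.trans_le ?_
    rw [ENNReal.le_div_iff_mul_le (Or.inl h0) (Or.inl ENNReal.ofReal_ne_top)]
    rw [lt_rearr_iff] at hl'
    obtain ⟨E, hEs, hEm, hEt⟩ := hna.exists_subset_measure_eq (measurableSet_lt_abs hf l') hl'
    refine le_trans ?_ (hE E hEm hEt.le)
    rw [← hEt, ← setLIntegral_const]
    exact setLIntegral_mono hf.abs.ennreal_ofReal fun x hx => (hEs hx).le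
  · refine hE _ (measurableSet_lt_abs hf _) ?_
    exact not_lt.1 fun h => lt_irrefl _ ((lt_rearr_iff μ f t _).2 h)

/-- The two-sided estimate of an associate functional from a weight `w` and its primitive `ψ`. -/
theorem assocNorm_equiv {X : Type*} [MeasurableSpace X] {μ : Measure X} [SigmaFinite μ]
    (hna : IsNonatomic μ) (N : (X → ℝ) → ℝ≥0∞) {ψ : ℝ → ℝ} {w : ℝ → ℝ≥0∞} (hw : Measurable w)
    {C₁ C₂ : ℝ≥0∞} {C₃ : ℝ} (hC₁ : C₁ < ∞) (hC₂ : C₂ < ∞) (hC₃ : 0 < C₃)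
    (hψ : ∀ t, 0 < t → 0 < ψ t)
    (hψw : ∀ t, 0 < t → ENNReal.ofReal (ψ t) ≤ C₁ * ∫⁻ s in Ioo (0:ℝ) t, w s)
    (hwN : ∀ g : X → ℝ, Measurable g → ∫⁻ s in Ioi (0:ℝ), w s * rearr μ g s ≤ C₂ * N g)
    (hN : ∀ t, 0 < t → ∀ E : Set X, MeasurableSet E → μ E ≤ ENNReal.ofReal t →
      N (E.indicator fun _ => (C₃ * ψ t)⁻¹) ≤ 1)
    (S : (X → ℝ) → ℝ≥0∞) (hS : ∀ f, S f = essSup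
      (fun t => ENNReal.ofReal (ψ t)⁻¹ * ∫⁻ s in Ioo (0:ℝ) t, rearr μ f s)
      (volume.restrict (Ioi 0))) :
    ∃ c C : ℝ≥0∞, 0 < c ∧ C < ∞ ∧ ∀ f : X → ℝ, Measurable f →
      c * S f ≤ assocNorm μ N f ∧ assocNorm μ N f ≤ C * S f := by
  refine ⟨(2 * ENNReal.ofReal C₃)⁻¹, C₁ * C₂, ENNReal.inv_pos.2 (by finiteness),
    ENNReal.mul_lt_top hC₁ hC₂, fun f hf => ⟨?_, ?_⟩⟩
  · rw [ENNReal.inv_mul_le_iff (by simp [hC₃]) (by finiteness), hS]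
    refine essSup_le_of_ae_le _ ((ae_restrict_iff' measurableSet_Ioi).2 (.of_forall fun t ht => ?_))
    have ht' : 0 < t := ht
    have h := lintegral_rearr_le_assocNorm hna N (mul_pos hC₃ (hψ t ht')) (hN t ht') hf
    calc ENNReal.ofReal (ψ t)⁻¹ * ∫⁻ s in Ioo (0:ℝ) t, rearr μ f s
        ≤ ENNReal.ofReal (ψ t)⁻¹ * (2 * ENNReal.ofReal (C₃ * ψ t) * assocNorm μ N f) := by
          gcongr
      _ = (ENNReal.ofReal (ψ t)⁻¹ * ENNReal.ofReal (ψ t)) *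
          (2 * ENNReal.ofReal C₃ * assocNorm μ N f) := by
          rw [ENNReal.ofReal_mul hC₃.le]; ring
      _ = _ := by
          rw [← ENNReal.ofReal_mul (inv_pos.2 (hψ t ht')).le, inv_mul_cancel₀ (hψ t ht').ne',
            ENNReal.ofReal_one, one_mul]
  · refine iSup_le fun g => iSup_le fun hg => iSup_le fun hNg => ?_
    have h : ∀ᵐ t ∂volume.restrict (Ioi (0:ℝ)), ∫⁻ s in Ioo (0:ℝ) t, rearr μ f s ≤
        (S f * C₁) * ∫⁻ s in Ioo (0:ℝ) t, w s := by
      have h1 := ENNReal.ae_le_essSup (μ := volume.restrict (Ioi (0:ℝ)))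
        (fun t => ENNReal.ofReal (ψ t)⁻¹ * ∫⁻ s in Ioo (0:ℝ) t, rearr μ f s)
      rw [← hS] at h1
      filter_upwards [h1, ae_restrict_mem measurableSet_Ioi] with t h1t ht
      have hψt := hψ t ht
      calc ∫⁻ s in Ioo (0:ℝ) t, rearr μ f s
          = ENNReal.ofReal (ψ t) * (ENNReal.ofReal (ψ t)⁻¹ *
              ∫⁻ s in Ioo (0:ℝ) t, rearr μ f s) := by
            rw [← mul_assoc, ← ENNReal.ofReal_mul hψt.le, mul_inv_cancel₀ hψt.ne',
              ENNReal.ofReal_one, one_mul]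
        _ ≤ (C₁ * ∫⁻ s in Ioo (0:ℝ) t, w s) * S f := by
            gcongr
            exact hψw t ht
        _ = _ := by ring
    calc _ ≤ (S f * C₁) * ∫⁻ s in Ioi (0:ℝ), w s * rearr μ g s :=
          lintegral_abs_mul_le μ hf hg hw _ h
      _ ≤ (S f * C₁) * (C₂ * 1) := by
          gcongr
          exact (hwN g hg).trans (by gcongr)
      _ = _ := by ring

theorem lkMaxNorm_top_eq {X : Type*} [MeasurableSpace X] (μ : Measure X) {r : ℝ≥0∞}
    {v ψ : ℝ → ℝ} (h : ∀ t, 0 < t → t ^ r⁻¹.toReal * v t * t⁻¹ = (ψ t)⁻¹) (f : X → ℝ) :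
    lkMaxNorm μ r ∞ v f = essSup
      (fun t => ENNReal.ofReal (ψ t)⁻¹ * ∫⁻ s in Ioo (0:ℝ) t, rearr μ f s)
      (volume.restrict (Ioi 0)) := by
  rw [lkMaxNorm, lqNorm, if_pos rfl]
  refine essSup_congr_ae ?_
  filter_upwards [ae_restrict_mem measurableSet_Ioi] with t ht
  have ht' : 0 < t := ht
  rw [maxf, ← mul_assoc, ← ENNReal.ofReal_inv_of_pos ht', ← ENNReal.ofReal_mul'
    (inv_pos.2 ht').le, ← h t ht', ENNReal.inv_top, ENNReal.toReal_zero, sub_zero]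

theorem IsSlowlyVarying.exists_rpow_mul_le {b : ℝ → ℝ} (hb : IsSlowlyVarying b) {ε : ℝ}
    (hε : 0 < ε) : ∃ C : ℝ, 0 < C ∧ ∀ s t, 0 < s → s ≤ t → s ^ ε * b s ≤ C * (t ^ ε * b t) := by
  obtain ⟨-, -, h⟩ := hb
  obtain ⟨⟨bp, hbp, c, C, hc, hC, hcC⟩, -⟩ := h ε hε
  refine ⟨C / c, by positivity, fun s t hs hst => ?_⟩
  have ht : 0 < t := hs.trans_le hst
  calc s ^ ε * b s ≤ C * bp s := (hcC s hs).2
    _ ≤ C * bp t := by gcongr; exact hbp hs ht hst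
    _ = C / c * (c * bp t) := by field_simp
    _ ≤ C / c * (t ^ ε * b t) :=
      mul_le_mul_of_nonneg_left (hcC t ht).1 (by positivity)

theorem IsSlowlyVarying.exists_le_rpow_neg_mul {b : ℝ → ℝ} (hb : IsSlowlyVarying b) {ε : ℝ}
    (hε : 0 < ε) :
    ∃ C : ℝ, 0 < C ∧ ∀ s t, 0 < s → s ≤ t → t ^ (-ε) * b t ≤ C * (s ^ (-ε) * b s) := by
  obtain ⟨-, -, h⟩ := hb
  obtain ⟨-, ⟨bm, hbm, c, C, hc, hC, hcC⟩⟩ := h ε hε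
  refine ⟨C / c, by positivity, fun s t hs hst => ?_⟩
  have ht : 0 < t := hs.trans_le hst
  calc t ^ (-ε) * b t ≤ C * bm t := (hcC t ht).2
    _ ≤ C * bm s := by gcongr; exact hbm hs ht hst
    _ = C / c * (c * bm s) := by field_simp
    _ ≤ C / c * (s ^ (-ε) * b s) :=
      mul_le_mul_of_nonneg_left (hcC s hs).1 (by positivity)

/-- Doubling: `φ(t) = t ^ a * b t` is controlled by its values on `(t/2, t)`. -/
theorem IsSlowlyVarying.exists_doubling {b : ℝ → ℝ} (hb : IsSlowlyVarying b) {a : ℝ}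
    (ha : 0 < a) : ∃ D : ℝ, 0 < D ∧ ∀ s t, 0 < t → s ∈ Ioo (t / 2) t →
      t ^ a * b t ≤ D * (s ^ a * b s) := by
  obtain ⟨C, hC, h⟩ := hb.exists_le_rpow_neg_mul one_pos
  refine ⟨2 ^ (a + 1) * C, by positivity, fun s t ht hs => ?_⟩
  have hs0 : 0 < s := by linarith [hs.1]
  have hbs := hb.2.1 s hs0
  have h1 := h s t hs0 hs.2.le
  calc t ^ a * b t = t ^ (a + 1) * (t ^ (-1:ℝ) * b t) := by
        rw [← mul_assoc, ← Real.rpow_add ht]; ring_nf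
    _ ≤ (2 * s) ^ (a + 1) * (C * (s ^ (-1:ℝ) * b s)) := by
        have := hb.2.1 t ht
        gcongr
        linarith [hs.1]
    _ = 2 ^ (a + 1) * C * (s ^ (a + 1) * s ^ (-1:ℝ) * b s) := by
        rw [Real.mul_rpow (by norm_num) hs0.le]; ring
    _ = _ := by rw [← Real.rpow_add hs0]; ring_nf

theorem setLIntegral_half_const_le (t : ℝ) (ht : 0 < t) (k : ℝ≥0∞) {F : ℝ → ℝ≥0∞}
    (hF : ∀ s ∈ Ioo (t / 2) t, k ≤ F s) :
    k ≤ 2 * ∫⁻ s in Ioo (t / 2) t, ENNReal.ofReal s⁻¹ * F s := by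
  have h1 : ∫⁻ _ in Ioo (t / 2) t, ENNReal.ofReal t⁻¹ * k ≤
      ∫⁻ s in Ioo (t / 2) t, ENNReal.ofReal s⁻¹ * F s := by
    refine setLIntegral_mono' measurableSet_Ioo fun s hs => ?_
    have hs0 : 0 < s := by linarith [hs.1]
    gcongr
    · exact hs.2.le
    · exact hF s hs
  rw [setLIntegral_const, Real.volume_Ioo] at h1
  calc k = 2 * (ENNReal.ofReal t⁻¹ * k * ENNReal.ofReal (t - t / 2)) := by
        have h2 : (2:ℝ≥0∞) = ENNReal.ofReal 2 := by simp
        rw [mul_right_comm, ← mul_assoc, h2, ← ENNReal.ofReal_mul (by positivity),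
          ← ENNReal.ofReal_mul (by norm_num)]
        have : 2 * (t⁻¹ * (t - t / 2)) = 1 := by field_simp; norm_num
        rw [this, ENNReal.ofReal_one, one_mul]
    _ ≤ _ := by gcongr

theorem lintegral_rpow_sub_one_Ioo {β t : ℝ} (hβ : 0 < β) (ht : 0 < t) :
    ∫⁻ s in Ioo (0:ℝ) t, ENNReal.ofReal (s ^ (β - 1)) = ENNReal.ofReal (t ^ β / β) := by
  have hint : IntegrableOn (fun s : ℝ => s ^ (β - 1)) (Ioo 0 t) :=
    (intervalIntegrable_iff_integrableOn_Ioo_of_le ht.le).1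
      (intervalIntegral.intervalIntegrable_rpow' (by linarith))
  rw [← ofReal_integral_eq_lintegral_ofReal hint
    ((ae_restrict_iff' measurableSet_Ioo).2 (.of_forall fun s hs => Real.rpow_nonneg hs.1.le _)),
    ← integral_Ioc_eq_integral_Ioo, ← intervalIntegral.integral_of_le ht.le,
    integral_rpow (Or.inl (by linarith)), sub_add_cancel, Real.zero_rpow hβ.ne', sub_zero]

/-- The functional `‖·‖_{p,q,b}` for `0 < q ≤ 1`, in terms of `φ(t) = t ^ (1/p) * b t`. -/
theorem lkNorm_eq {X : Type*} [MeasurableSpace X] (μ : Measure X) (p : ℝ≥0∞) {q : ℝ≥0∞}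
    (hq0 : 0 < q) (hq : q ≤ 1) {b : ℝ → ℝ} (hb : IsSlowlyVarying b) (g : X → ℝ) :
    lkNorm μ p q b g = (∫⁻ s in Ioi (0:ℝ), ENNReal.ofReal s⁻¹ *
      (ENNReal.ofReal (s ^ p⁻¹.toReal * b s) * rearr μ g s) ^ q.toReal) ^ (1 / q.toReal) := by
  have hqt : q ≠ ∞ := (hq.trans_lt ENNReal.one_lt_top).ne
  have hr : 0 < q.toReal := ENNReal.toReal_pos hq0.ne' hqt
  rw [lkNorm, lqNorm, if_neg hqt]
  congr 1
  refine setLIntegral_congr_fun measurableSet_Ioi fun s hs => ?_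
  have hs0 : 0 < s := hs
  have hbs := hb.2.1 s hs
  have h1 : s ^ (p⁻¹.toReal - q⁻¹.toReal) * b s = s ^ (-q.toReal⁻¹) * (s ^ p⁻¹.toReal * b s) := by
    rw [← mul_assoc, ← Real.rpow_add hs0, ENNReal.toReal_inv q]; ring_nf
  rw [h1, ENNReal.ofReal_mul (by positivity), mul_assoc, ENNReal.mul_rpow_of_nonneg _ _ hr.le,
    ENNReal.ofReal_rpow_of_pos (by positivity), ← Real.rpow_mul hs0.le, neg_mul,
    inv_mul_cancel₀ hr.ne', Real.rpow_neg_one]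

theorem lintegral_mul_rearr_le_lkNorm {X : Type*} [MeasurableSpace X] (μ : Measure X) {p : ℝ≥0∞}
    (ha : 0 < p⁻¹.toReal) {q : ℝ≥0∞} (hq0 : 0 < q) (hq : q ≤ 1) {b : ℝ → ℝ}
    (hb : IsSlowlyVarying b) :
    ∃ C : ℝ≥0∞, C < ∞ ∧ ∀ g : X → ℝ, Measurable g →
      ∫⁻ s in Ioi (0:ℝ), ENNReal.ofReal s⁻¹ * ENNReal.ofReal (s ^ p⁻¹.toReal * b s) * rearr μ g s
        ≤ C * lkNorm μ p q b g := by
  have hqt : q ≠ ∞ := (hq.trans_lt ENNReal.one_lt_top).ne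
  have hr : 0 < q.toReal := ENNReal.toReal_pos hq0.ne' hqt
  have hr1 : q.toReal ≤ 1 := ENNReal.toReal_le_of_le_ofReal zero_le_one (by simpa using hq)
  obtain ⟨D, hD, hdoub⟩ := hb.exists_doubling ha
  set a := p⁻¹.toReal
  set r := q.toReal
  set K : ℝ≥0∞ := ENNReal.ofReal D * 2 ^ (1 / r) with hKdef
  refine ⟨K ^ (1 - r), ENNReal.rpow_lt_top_of_nonneg (by linarith)
    (ENNReal.mul_ne_top ENNReal.ofReal_ne_top
      (ENNReal.rpow_ne_top_of_nonneg (by positivity) (by norm_num))), fun g _ => ?_⟩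
  rw [lkNorm_eq μ p hq0 hq hb]
  set u : ℝ → ℝ≥0∞ := fun s => ENNReal.ofReal (s ^ a * b s) * rearr μ g s with hu
  have hum : Measurable u :=
    (((measurable_id.pow_const a).mul hb.1).ennreal_ofReal).mul (measurable_rearr μ g)
  have hFm : Measurable fun s : ℝ => ENNReal.ofReal s⁻¹ * u s ^ r :=
    measurable_inv.ennreal_ofReal.mul (hum.pow_const r)
  set A := ∫⁻ s in Ioi (0:ℝ), ENNReal.ofReal s⁻¹ * u s ^ r with hA
  have hpt : ∀ t, 0 < t → u t ≤ K * A ^ (1 / r) := by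
    intro t ht
    have h1 : u t ^ r ≤ 2 * ∫⁻ s in Ioo (t / 2) t,
        ENNReal.ofReal s⁻¹ * (ENNReal.ofReal D * u s) ^ r := by
      refine setLIntegral_half_const_le t ht _ fun s hs => ?_
      refine ENNReal.rpow_le_rpow ?_ hr.le
      rw [hu]
      simp only
      rw [← mul_assoc, ← ENNReal.ofReal_mul hD.le]
      refine mul_le_mul' (ENNReal.ofReal_le_ofReal ?_) ?_
      · exact hdoub s t ht hs
      · exact rearr_antitone μ g hs.2.le
    have h2 : ∫⁻ s in Ioo (t / 2) t, ENNReal.ofReal s⁻¹ * (ENNReal.ofReal D * u s) ^ r ≤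
        ENNReal.ofReal D ^ r * A := by
      rw [hA, ← lintegral_const_mul _ hFm]
      refine (lintegral_mono_set fun s hs => ?_).trans (lintegral_mono fun s => ?_)
      · exact lt_trans (by linarith) hs.1
      · rw [ENNReal.mul_rpow_of_nonneg _ _ hr.le, mul_left_comm]
    have h3 : u t ^ r ≤ 2 * (ENNReal.ofReal D ^ r * A) := h1.trans (by gcongr)
    have h4 := ENNReal.rpow_le_rpow h3 (z := 1 / r) (by positivity)
    rw [← ENNReal.rpow_mul, mul_one_div_cancel hr.ne', ENNReal.rpow_one,
      ENNReal.mul_rpow_of_nonneg _ _ (by positivity), ENNReal.mul_rpow_of_nonneg _ _ (by positivity),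
      ← ENNReal.rpow_mul, mul_one_div_cancel hr.ne', ENNReal.rpow_one] at h4
    rw [hKdef]
    exact h4.trans (le_of_eq (by ring))
  calc ∫⁻ s in Ioi (0:ℝ), ENNReal.ofReal s⁻¹ * ENNReal.ofReal (s ^ a * b s) * rearr μ g s
      ≤ ∫⁻ s in Ioi (0:ℝ), (K * A ^ (1 / r)) ^ (1 - r) * (ENNReal.ofReal s⁻¹ * u s ^ r) := by
        refine setLIntegral_mono' measurableSet_Ioi fun s hs => ?_
        calc _ = ENNReal.ofReal s⁻¹ * u s := mul_assoc _ _ _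
          _ = u s ^ (1 - r) * (ENNReal.ofReal s⁻¹ * u s ^ r) := by
              rw [mul_left_comm (u s ^ (1 - r)), ← ENNReal.rpow_add_of_nonneg _ _ (by linarith) hr.le,
                sub_add_cancel, ENNReal.rpow_one]
          _ ≤ _ := by
              refine mul_le_mul' (ENNReal.rpow_le_rpow (hpt s hs) ?_) le_rfl
              linarith
    _ = (K * A ^ (1 / r)) ^ (1 - r) * A :=
        lintegral_const_mul _ hFm
    _ = K ^ (1 - r) * A ^ (1 / r) := by
        rw [ENNReal.mul_rpow_of_nonneg _ _ (by linarith), ← ENNReal.rpow_mul, mul_assoc]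
        congr 1
        conv_lhs => enter [2]; rw [← ENNReal.rpow_one A]
        rw [← ENNReal.rpow_add_of_nonneg _ _ (mul_nonneg (by positivity) (by linarith)) zero_le_one]
        congr 1
        field_simp
        ring

theorem lkNorm_indicator_le_one {X : Type*} [MeasurableSpace X] (μ : Measure X) {p : ℝ≥0∞}
    (ha : 0 < p⁻¹.toReal) {q : ℝ≥0∞} (hq0 : 0 < q) (hq : q ≤ 1) {b : ℝ → ℝ}
    (hb : IsSlowlyVarying b) :
    ∃ C : ℝ, 0 < C ∧ ∀ t, 0 < t → ∀ E : Set X, MeasurableSet E → μ E ≤ ENNReal.ofReal t →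
      lkNorm μ p q b (E.indicator fun _ => (C * (t ^ p⁻¹.toReal * b t))⁻¹) ≤ 1 := by
  have hqt : q ≠ ∞ := (hq.trans_lt ENNReal.one_lt_top).ne
  have hr : 0 < q.toReal := ENNReal.toReal_pos hq0.ne' hqt
  simp only [lkNorm_eq μ p hq0 hq hb]
  set a := p⁻¹.toReal
  set r := q.toReal
  obtain ⟨C, hC, hmono⟩ := hb.exists_rpow_mul_le (half_pos ha)
  have hβ : 0 < a / 2 * r := by positivity
  set L : ℝ := (a / 2 * r)⁻¹ ^ r⁻¹ with hL
  have hL0 : 0 < L := by positivity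
  refine ⟨C * L, by positivity, fun t ht E _ hEt => ?_⟩
  have hbt := hb.2.1 t ht
  set κ : ℝ := (C * L * (t ^ a * b t))⁻¹ with hκ
  have hκ0 : 0 < κ := by positivity
  set B : ℝ := C * (t ^ (a / 2) * b t) * κ with hB
  have hBval : B = L⁻¹ * t ^ (-(a / 2)) := by
    rw [hB, hκ, Real.rpow_neg ht.le]
    have : t ^ a = t ^ (a / 2) * t ^ (a / 2) := by rw [← Real.rpow_add ht]; ring_nf
    rw [this]
    field_simp
  have hB0 : 0 < B := by positivity
  refine ENNReal.rpow_le_one ?_ (by positivity)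
  calc ∫⁻ s in Ioi (0:ℝ), ENNReal.ofReal s⁻¹ *
        (ENNReal.ofReal (s ^ a * b s) * rearr μ (E.indicator fun _ => κ) s) ^ r
      ≤ ∫⁻ s in Ioi (0:ℝ), (Iio t).indicator
          (fun s => ENNReal.ofReal (B ^ r) * ENNReal.ofReal (s ^ (a / 2 * r - 1))) s := by
        refine setLIntegral_mono' measurableSet_Ioi fun s hs => ?_
        have hs0 : 0 < s := hs
        have hbs := hb.2.1 s hs
        have h1 := rearr_indicator_le μ E hκ0.le hEt s
        by_cases hst : s ∈ Iio t
        · rw [indicator_of_mem hst] at h1 ⊢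
          calc _ ≤ ENNReal.ofReal s⁻¹ * (ENNReal.ofReal (s ^ a * b s) * ENNReal.ofReal κ) ^ r := by
                gcongr
            _ = ENNReal.ofReal (s⁻¹ * (s ^ a * b s * κ) ^ r) := by
                rw [← ENNReal.ofReal_mul (by positivity),
                  ENNReal.ofReal_rpow_of_nonneg (by positivity) hr.le,
                  ← ENNReal.ofReal_mul (by positivity)]
            _ ≤ ENNReal.ofReal (s⁻¹ * (s ^ (a / 2) * B) ^ r) := by
                have h2 := hmono s t hs0 (le_of_lt hst)
                have h3 : s ^ a = s ^ (a / 2) * s ^ (a / 2) := by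
                  rw [← Real.rpow_add hs0]; ring_nf
                have h4 : s ^ a * b s * κ ≤ s ^ (a / 2) * B := by
                  rw [h3, hB, mul_assoc (s ^ (a / 2)), mul_assoc (s ^ (a / 2))]
                  gcongr
                gcongr
            _ = _ := by
                rw [← ENNReal.ofReal_mul (by positivity), Real.mul_rpow (by positivity) hB0.le,
                  ← Real.rpow_mul hs0.le, Real.rpow_sub_one hs0.ne']
                congr 1
                field_simp
        · rw [indicator_of_notMem hst] at h1 ⊢
          rw [nonpos_iff_eq_zero.1 h1]
          simp [hr]
    _ = ENNReal.ofReal (B ^ r) * ENNReal.ofReal (t ^ (a / 2 * r) / (a / 2 * r)) := by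
        rw [setLIntegral_indicator measurableSet_Iio, inter_comm, Ioi_inter_Iio,
          lintegral_const_mul _ (by fun_prop), lintegral_rpow_sub_one_Ioo hβ ht]
    _ = 1 := by
        rw [← ENNReal.ofReal_mul (by positivity), ← ENNReal.ofReal_one]
        congr 1
        rw [hBval, Real.mul_rpow (by positivity) (by positivity), ← Real.rpow_mul ht.le,
          Real.inv_rpow hL0.le, hL, ← Real.rpow_mul (by positivity), inv_mul_cancel₀ hr.ne',
          Real.rpow_one, neg_mul, Real.rpow_neg ht.le]
        field_simp

theorem svTilde_lt_top {b : ℝ → ℝ} (hb : IsSlowlyVarying b)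
    (h : ∫⁻ t in Ioo (0:ℝ) 1, ENNReal.ofReal (t⁻¹ * b t) < ∞) (t : ℝ) : svTilde b t < ∞ := by
  obtain ⟨C, hC, hmono⟩ := hb.exists_rpow_mul_le one_pos
  have hsub : Ioo (0:ℝ) t ⊆ Ioo 0 1 ∪ Ico 1 t := fun s hs => by
    rcases lt_or_ge s 1 with h1 | h1
    · exact Or.inl ⟨hs.1, h1⟩
    · exact Or.inr ⟨h1, hs.2⟩
  refine (lintegral_mono_set hsub).trans_lt ((lintegral_union_le _ _ _).trans_lt
    (ENNReal.add_lt_top.2 ⟨h, ?_⟩))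
  refine (setLIntegral_mono' (g := fun _ => ENNReal.ofReal (C * (t * b t))) measurableSet_Ico
    fun s hs => ENNReal.ofReal_le_ofReal ?_).trans_lt ?_
  · have hs0 : 0 < s := one_pos.trans_le hs.1
    have h1 := hmono s t hs0 hs.2.le
    rw [Real.rpow_one, Real.rpow_one] at h1
    have hbs := hb.2.1 s hs0
    refine le_trans ?_ h1
    gcongr
    exact (inv_le_one_of_one_le₀ hs.1).trans hs.1
  · rw [setLIntegral_const, Real.volume_Ico]
    finiteness

theorem svTilde_pos {b : ℝ → ℝ} (hb : IsSlowlyVarying b) {t : ℝ} (ht : 0 < t) :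
    0 < svTilde b t := by
  have hm : Measurable fun s => ENNReal.ofReal (s⁻¹ * b s) :=
    (measurable_inv.mul hb.1).ennreal_ofReal
  rw [svTilde, setLIntegral_pos_iff hm]
  refine lt_of_lt_of_le ?_ (measure_mono (s := Ioo 0 t) fun s hs => ⟨?_, hs⟩)
  · simpa [Real.volume_Ioo] using ht
  · have := hb.2.1 s hs.1
    have := hs.1
    simp only [Function.mem_support, ne_eq, ENNReal.ofReal_eq_zero, not_le]
    positivity

/-- Theorem T2AS: associate spaces of `L^{p,q,b}` for `q ∈ (0,1]`. -/
theorem lk_assoc_small_q {X : Type*} [MeasurableSpace X] (μ : Measure X)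
    [SigmaFinite μ] (hna : IsNonatomic μ) (hμ : μ Set.univ = ∞)
    (p q : ℝ≥0∞) (hp : 0 < p) (hq0 : 0 < q) (hq : q ≤ 1)
    (b : ℝ → ℝ) (hb : IsSlowlyVarying b) :
    (((1 < p ∧ p < ∞) ∨
        (p = 1 ∧ ∃ b0 : ℝ → ℝ, AntitoneOn b0 (Set.Ioi 0) ∧ EquivOn b b0 (Set.Ioi 0))) →
      ∃ c C : ℝ≥0∞, 0 < c ∧ C < ∞ ∧ ∀ f : X → ℝ, Measurable f →
        c * lkMaxNorm μ (conjE p) ∞ (fun t => (b t)⁻¹) f ≤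
          assocNorm μ (lkNorm μ p q b) f ∧
        assocNorm μ (lkNorm μ p q b) f ≤
          C * lkMaxNorm μ (conjE p) ∞ (fun t => (b t)⁻¹) f) ∧
    ((p = ∞ ∧ q = 1 ∧ ∫⁻ t in Set.Ioo (0:ℝ) 1, ENNReal.ofReal (t⁻¹ * b t) < ∞) →
      ∃ c C : ℝ≥0∞, 0 < c ∧ C < ∞ ∧ ∀ f : X → ℝ, Measurable f →
        c * lkMaxNorm μ 1 ∞ (fun t => ((svTilde b t).toReal)⁻¹) f ≤
          assocNorm μ (lkNorm μ ∞ 1 b) f ∧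
        assocNorm μ (lkNorm μ ∞ 1 b) f ≤
          C * lkMaxNorm μ 1 ∞ (fun t => ((svTilde b t).toReal)⁻¹) f) := by
  refine ⟨fun h => ?_, fun ⟨hp', hq', hint⟩ => ?_⟩
  · have hp1 : 1 ≤ p := h.elim (fun h => h.1.le) fun h => h.1.ge
    have hpt : p ≠ ∞ := h.elim (fun h => h.2.ne) fun h => h.1 ▸ ENNReal.one_ne_top
    have hpinv : p⁻¹ ≤ 1 := ENNReal.inv_le_one.2 hp1
    have ha : 0 < p⁻¹.toReal :=
      ENNReal.toReal_pos (ENNReal.inv_ne_zero.2 hpt) (ENNReal.inv_ne_top.2 hp.ne')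
    have hconj : (conjE p)⁻¹.toReal = 1 - p⁻¹.toReal := by
      rw [conjE, inv_inv, ENNReal.toReal_sub_of_le hpinv ENNReal.one_ne_top, ENNReal.toReal_one]
    obtain ⟨D, hD, hdoub⟩ := hb.exists_doubling ha
    obtain ⟨C₂, hC₂, hwN⟩ := lintegral_mul_rearr_le_lkNorm μ ha hq0 hq hb
    obtain ⟨C₃, hC₃, hN⟩ := lkNorm_indicator_le_one μ ha hq0 hq hb
    refine assocNorm_equiv hna (lkNorm μ p q b) (ψ := fun t => t ^ p⁻¹.toReal * b t)
      (w := fun s => ENNReal.ofReal s⁻¹ * ENNReal.ofReal (s ^ p⁻¹.toReal * b s))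
      (measurable_inv.ennreal_ofReal.mul
        ((measurable_id.pow_const p⁻¹.toReal).mul hb.1).ennreal_ofReal)
      (C₁ := 2 * ENNReal.ofReal D) (by finiteness) hC₂ hC₃
      (fun t ht => mul_pos (Real.rpow_pos_of_pos ht _) (hb.2.1 t ht)) (fun t ht => ?_) hwN hN _
      (lkMaxNorm_top_eq μ fun t ht => ?_)
    · refine (setLIntegral_half_const_le t ht _
        (F := fun s => ENNReal.ofReal D * ENNReal.ofReal (s ^ p⁻¹.toReal * b s))
        fun s hs => ?_).trans ?_
      · rw [← ENNReal.ofReal_mul hD.le]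
        exact ENNReal.ofReal_le_ofReal (hdoub s t ht hs)
      · simp_rw [mul_left_comm _ (ENNReal.ofReal D)]
        rw [lintegral_const_mul' _ _ ENNReal.ofReal_ne_top, mul_assoc]
        gcongr
        linarith
    · rw [hconj, Real.rpow_sub ht, Real.rpow_one]
      have := hb.2.1 t ht
      field_simp
  · subst hp' hq'
    have hfin := svTilde_lt_top hb hint
    have hpos : ∀ t, 0 < t → 0 < (svTilde b t).toReal := fun t ht =>
      ENNReal.toReal_pos (svTilde_pos hb ht).ne' (hfin t).ne
    have hw : Measurable fun s => ENNReal.ofReal (s⁻¹ * b s) :=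
      (measurable_inv.mul hb.1).ennreal_ofReal
    have hnorm : ∀ g : X → ℝ, lkNorm μ ∞ 1 b g =
        ∫⁻ s in Ioi (0:ℝ), ENNReal.ofReal (s⁻¹ * b s) * rearr μ g s := fun g => by
      simp [lkNorm, lqNorm, Real.rpow_neg_one]
    refine assocNorm_equiv hna (lkNorm μ ∞ 1 b) (ψ := fun t => (svTilde b t).toReal) hw
      (C₁ := 1) (C₂ := 1) (C₃ := 1) ENNReal.one_lt_top ENNReal.one_lt_top one_pos hpos
      (fun t ht => ?_) (fun g hg => ?_) (fun t ht E _ hEt => ?_) _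
      (lkMaxNorm_top_eq μ fun t ht => ?_)
    · rw [ENNReal.ofReal_toReal (hfin t).ne, one_mul, svTilde]
    · rw [hnorm, one_mul]
    · have hB := hpos t ht
      rw [hnorm, one_mul]
      calc ∫⁻ s in Ioi (0:ℝ), ENNReal.ofReal (s⁻¹ * b s) *
            rearr μ (E.indicator fun _ => (svTilde b t).toReal⁻¹) s
          ≤ ∫⁻ s in Ioi (0:ℝ), (Iio t).indicator (fun s => ENNReal.ofReal (svTilde b t).toReal⁻¹ *
              ENNReal.ofReal (s⁻¹ * b s)) s := by
            refine lintegral_mono fun s => ?_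
            have h1 := rearr_indicator_le μ E (inv_pos.2 hB).le hEt s
            by_cases hs : s ∈ Iio t
            · rw [indicator_of_mem hs] at h1 ⊢
              rw [mul_comm]
              gcongr
            · rw [indicator_of_notMem hs] at h1 ⊢
              simp [nonpos_iff_eq_zero.1 h1]
        _ = ENNReal.ofReal (svTilde b t).toReal⁻¹ * ENNReal.ofReal (svTilde b t).toReal := by
            rw [setLIntegral_indicator measurableSet_Iio, inter_comm, Ioi_inter_Iio,
              lintegral_const_mul _ hw, ENNReal.ofReal_toReal (hfin t).ne, svTilde]
        _ ≤ 1 := by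
            rw [← ENNReal.ofReal_mul (inv_pos.2 hB).le, inv_mul_cancel₀ hB.ne', ENNReal.ofReal_one]
    · rw [inv_one, ENNReal.toReal_one, Real.rpow_one]
      field_simp
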